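/- arXiv:2405.09815 — 5 statements merged into one kernel-verified Lean document; each statement's English description precedes it below -/
import Mathlib

section
/- Let X be a compact metric space, let A₁ and A₂ be closed subalgebras of C(X) containing the constants, and let f ∈ C(X). Suppose {x₁, x₂, ..., x_{2n}} is a closed bolt with respect to A₁ and A₂, and u ∈ A₁ + A₂ is a function such that f(x_i) − u(x_i) = (−1)^i |f(x_i) − u(x_i)| for all i = 1, ..., 2n. Then E(f) ≥ min_{1 ≤ i ≤ 2n} |f(x_i) − u(x_i)|. -/
open Filter Topology

/-- Two points `a, b` of `X` are linked via the algebra `A ⊆ C(X)` if every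
element of `A` takes equal values at `a` and `b`. -/
def AlgLink {X : Type*} [TopologicalSpace X] (A : Subalgebra ℝ C(X, ℝ)) (a b : X) : Prop :=
  ∀ g : C(X, ℝ), g ∈ A → g a = g b

/-- `x 0, x 1, ..., x (n-1)` is a finite (lightning) bolt with respect to the
algebras `A₁, A₂`: consecutive points are distinct and the consecutive links
alternate between `A₁`-links and `A₂`-links (in one of the two possible orders). -/
def IsFiniteBolt {X : Type*} [TopologicalSpace X] (A₁ A₂ : Subalgebra ℝ C(X, ℝ)) {n : ℕ}
    (x : Fin n → X) : Prop :=
  (∀ (i : ℕ) (h : i + 1 < n), x ⟨i, Nat.lt_of_succ_lt h⟩ ≠ x ⟨i + 1, h⟩) ∧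
  ((∀ (i : ℕ) (h : i + 1 < n),
      if Even i then AlgLink A₁ (x ⟨i, Nat.lt_of_succ_lt h⟩) (x ⟨i + 1, h⟩)
      else AlgLink A₂ (x ⟨i, Nat.lt_of_succ_lt h⟩) (x ⟨i + 1, h⟩)) ∨
   (∀ (i : ℕ) (h : i + 1 < n),
      if Even i then AlgLink A₂ (x ⟨i, Nat.lt_of_succ_lt h⟩) (x ⟨i + 1, h⟩)
      else AlgLink A₁ (x ⟨i, Nat.lt_of_succ_lt h⟩) (x ⟨i + 1, h⟩)))

/-- The cyclically next index in `Fin m`. -/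
def nextIdx {m : ℕ} (i : Fin m) : Fin m := ⟨((i : ℕ) + 1) % m, Nat.mod_lt _ i.pos⟩

/-- `x 0, ..., x (m-1)` is a closed bolt with respect to `A₁, A₂`: the number of
points is even and positive, cyclically consecutive points are distinct, and the
cyclic links alternate between `A₁`-links and `A₂`-links. -/
def IsClosedBolt {X : Type*} [TopologicalSpace X] (A₁ A₂ : Subalgebra ℝ C(X, ℝ)) {m : ℕ}
    (x : Fin m → X) : Prop :=
  0 < m ∧ Even m ∧
  (∀ i : Fin m, x i ≠ x (nextIdx i)) ∧
  ((∀ i : Fin m, if Even (i : ℕ) then AlgLink A₁ (x i) (x (nextIdx i))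
      else AlgLink A₂ (x i) (x (nextIdx i))) ∨
   (∀ i : Fin m, if Even (i : ℕ) then AlgLink A₂ (x i) (x (nextIdx i))
      else AlgLink A₁ (x i) (x (nextIdx i))))

/-- `x 0, x 1, x 2, ...` is an infinite bolt with respect to `A₁, A₂`. -/
def IsInfiniteBolt {X : Type*} [TopologicalSpace X] (A₁ A₂ : Subalgebra ℝ C(X, ℝ))
    (x : ℕ → X) : Prop :=
  (∀ i : ℕ, x i ≠ x (i + 1)) ∧
  ((∀ i : ℕ, if Even i then AlgLink A₁ (x i) (x (i + 1)) else AlgLink A₂ (x i) (x (i + 1))) ∨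
   (∀ i : ℕ, if Even i then AlgLink A₂ (x i) (x (i + 1)) else AlgLink A₁ (x i) (x (i + 1))))

/-- The bolt functional `r_l(F) = (1/n) ∑_{i=1}^n (-1)^{i+1} F(xᵢ)` associated with
the finite bolt `l = {x 0, ..., x (n-1)}` (here indexed from `0`). -/
noncomputable def boltFun {X : Type*} [TopologicalSpace X] {n : ℕ} (x : Fin n → X)
    (F : C(X, ℝ)) : ℝ :=
  (n : ℝ)⁻¹ * ∑ i : Fin n, (-1 : ℝ) ^ (i : ℕ) * F (x i)

/-- The set `A₁ + A₂ = {u₁ + u₂ : u₁ ∈ A₁, u₂ ∈ A₂}`. -/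
def algSum {X : Type*} [TopologicalSpace X] (A₁ A₂ : Subalgebra ℝ C(X, ℝ)) : Set C(X, ℝ) :=
  {u | ∃ u₁ ∈ A₁, ∃ u₂ ∈ A₂, u = u₁ + u₂}

/-- The approximation error `E(f) = inf_{u ∈ A₁+A₂} ‖f - u‖`. -/
noncomputable def approxError {X : Type*} [TopologicalSpace X] [CompactSpace X]
    (A₁ A₂ : Subalgebra ℝ C(X, ℝ)) (f : C(X, ℝ)) : ℝ :=
  ⨅ u : algSum A₁ A₂, ‖f - (u : C(X, ℝ))‖

/-- A finite bolt `x 0, ..., x (n-1)` is extremal for `h ∈ C(X)` if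
`h (x i) = (-1)^i ‖h‖` for all `i`, or `h (x i) = (-1)^{i+1} ‖h‖` for all `i`. -/
def ExtremalFin {X : Type*} [TopologicalSpace X] [CompactSpace X] {n : ℕ}
    (h : C(X, ℝ)) (x : Fin n → X) : Prop :=
  (∀ i : Fin n, h (x i) = (-1 : ℝ) ^ (i : ℕ) * ‖h‖) ∨
  (∀ i : Fin n, h (x i) = (-1 : ℝ) ^ ((i : ℕ) + 1) * ‖h‖)

/-- An infinite bolt `x 0, x 1, ...` is extremal for `h ∈ C(X)` if
`h (x i) = (-1)^i ‖h‖` for all `i`, or `h (x i) = (-1)^{i+1} ‖h‖` for all `i`. -/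
def ExtremalSeq {X : Type*} [TopologicalSpace X] [CompactSpace X]
    (h : C(X, ℝ)) (x : ℕ → X) : Prop :=
  (∀ i : ℕ, h (x i) = (-1 : ℝ) ^ i * ‖h‖) ∨
  (∀ i : ℕ, h (x i) = (-1 : ℝ) ^ (i + 1) * ‖h‖)

theorem nextIdx_injective {m : ℕ} : Function.Injective (nextIdx : Fin m → Fin m) := by
  intro i j h
  have h' : ((i : ℕ) + 1) % m = ((j : ℕ) + 1) % m := congrArg Fin.val h
  have hi := i.isLt
  have hj := j.isLt
  apply Fin.ext
  rcases Nat.lt_or_ge (i + 1) m with h1 | h1 <;> rcases Nat.lt_or_ge (j + 1) m with h2 | h2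
  · rw [Nat.mod_eq_of_lt h1, Nat.mod_eq_of_lt h2] at h'
    omega
  · have e : (j : ℕ) + 1 = m := by omega
    rw [Nat.mod_eq_of_lt h1, e, Nat.mod_self] at h'
    omega
  · have e : (i : ℕ) + 1 = m := by omega
    rw [Nat.mod_eq_of_lt h2, e, Nat.mod_self] at h'
    omega
  · omega

theorem neg_one_pow_nextIdx {m : ℕ} (hm : Even m) (i : Fin m) :
    (-1 : ℝ) ^ (nextIdx i : ℕ) = -(-1 : ℝ) ^ (i : ℕ) := by
  have h : Even (nextIdx i : ℕ) ↔ Even ((i : ℕ) + 1) := Even.mod_even_iff hm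
  rw [neg_one_pow_congr h, pow_succ, mul_neg_one]

/-- The alternating sum of `a` over a cycle of even length vanishes if `a` is constant along every
edge starting at an index `i` with `(-1) ^ i = s`. -/
theorem sum_neg_one_pow_mul_eq_zero {m : ℕ} (hm : Even m) (a : Fin m → ℝ) {s : ℝ} (hs : s * s = 1)
    (h : ∀ i : Fin m, (-1 : ℝ) ^ (i : ℕ) = s → a i = a (nextIdx i)) :
    ∑ i : Fin m, (-1 : ℝ) ^ (i : ℕ) * a i = 0 := by
  have hshift : ∑ i : Fin m, (1 + s * (-1 : ℝ) ^ (i : ℕ)) * a (nextIdx i) =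
      ∑ i : Fin m, (1 - s * (-1 : ℝ) ^ (i : ℕ)) * a i := by
    rw [← Function.Bijective.sum_comp (Finite.injective_iff_bijective.mp nextIdx_injective)
      (fun i : Fin m => (1 - s * (-1 : ℝ) ^ (i : ℕ)) * a i)]
    refine Finset.sum_congr rfl fun i _ => ?_
    rw [neg_one_pow_nextIdx hm]
    ring
  have hedge : ∑ i : Fin m, (1 + s * (-1 : ℝ) ^ (i : ℕ)) * a i =
      ∑ i : Fin m, (1 + s * (-1 : ℝ) ^ (i : ℕ)) * a (nextIdx i) := by
    refine Finset.sum_congr rfl fun i _ => ?_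
    by_cases hi : (-1 : ℝ) ^ (i : ℕ) = s
    · rw [h i hi]
    · have hsq : ((-1 : ℝ) ^ (i : ℕ) - s) * ((-1 : ℝ) ^ (i : ℕ) + s) = 0 := by
        have : (-1 : ℝ) ^ (i : ℕ) * (-1 : ℝ) ^ (i : ℕ) = 1 := by
          rw [← mul_pow]; norm_num
        linear_combination this - hs
      have hneg : (-1 : ℝ) ^ (i : ℕ) = -s := by
        rcases mul_eq_zero.mp hsq with h0 | h0
        · exact absurd (sub_eq_zero.mp h0) hi
        · linarith
      have : 1 + s * (-1 : ℝ) ^ (i : ℕ) = 0 := by rw [hneg]; linarith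
      rw [this, zero_mul, zero_mul]
  rw [hshift] at hedge
  have htwo : s * ∑ i : Fin m, (-1 : ℝ) ^ (i : ℕ) * a i = 0 := by
    have : 2 * (s * ∑ i : Fin m, (-1 : ℝ) ^ (i : ℕ) * a i) =
        ∑ i : Fin m, (1 + s * (-1 : ℝ) ^ (i : ℕ)) * a i -
          ∑ i : Fin m, (1 - s * (-1 : ℝ) ^ (i : ℕ)) * a i := by
      rw [← Finset.sum_sub_distrib, Finset.mul_sum, Finset.mul_sum]
      exact Finset.sum_congr rfl fun i _ => by ring
    linarith
  calc _ = s * (s * ∑ i : Fin m, (-1 : ℝ) ^ (i : ℕ) * a i) := by rw [← mul_assoc, hs, one_mul]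
    _ = 0 := by rw [htwo, mul_zero]

/-- The alternating sum over a closed bolt annihilates `A₁ + A₂`. -/
theorem IsClosedBolt.sum_eq_zero {X : Type*} [TopologicalSpace X] {A₁ A₂ : Subalgebra ℝ C(X, ℝ)}
    {m : ℕ} {x : Fin m → X} (hx : IsClosedBolt A₁ A₂ x) {v : C(X, ℝ)} (hv : v ∈ algSum A₁ A₂) :
    ∑ i : Fin m, (-1 : ℝ) ^ (i : ℕ) * v (x i) = 0 := by
  obtain ⟨-, hm, -, hlink⟩ := hx
  obtain ⟨g, hg, h, hh, rfl⟩ := hv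
  have alternating (B₁ B₂ : Subalgebra ℝ C(X, ℝ))
      (hB : ∀ i : Fin m, if Even (i : ℕ) then AlgLink B₁ (x i) (x (nextIdx i))
        else AlgLink B₂ (x i) (x (nextIdx i))) :
      (∀ w ∈ B₁, ∑ i : Fin m, (-1 : ℝ) ^ (i : ℕ) * w (x i) = 0) ∧
        ∀ w ∈ B₂, ∑ i : Fin m, (-1 : ℝ) ^ (i : ℕ) * w (x i) = 0 := by
    constructor <;> intro w hw
    · refine sum_neg_one_pow_mul_eq_zero hm (fun i => w (x i)) (s := 1) (by norm_num) fun i hi => ?_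
      have := hB i
      rw [if_pos ((neg_one_pow_eq_one_iff_even (by norm_num)).mp hi)] at this
      exact this w hw
    · refine sum_neg_one_pow_mul_eq_zero hm (fun i => w (x i)) (s := -1) (by norm_num)
        fun i hi => ?_
      have := hB i
      rw [if_neg fun he => by rw [he.neg_one_pow] at hi; norm_num at hi] at this
      exact this w hw
  simp only [ContinuousMap.add_apply, mul_add, Finset.sum_add_distrib]
  rcases hlink with hlink | hlink
  · rw [(alternating A₁ A₂ hlink).1 g hg, (alternating A₁ A₂ hlink).2 h hh, add_zero]
  · rw [(alternating A₂ A₁ hlink).2 g hg, (alternating A₂ A₁ hlink).1 h hh, add_zero]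

theorem deLaValleePoussin_closedBolt {X : Type*} [MetricSpace X] [CompactSpace X]
    (A₁ A₂ : Subalgebra ℝ C(X, ℝ))
    (hA₁ : IsClosed (A₁ : Set C(X, ℝ))) (hA₂ : IsClosed (A₂ : Set C(X, ℝ)))
    (f : C(X, ℝ)) {m : ℕ} (x : Fin m → X) (hx : IsClosedBolt A₁ A₂ x)
    (u : C(X, ℝ)) (hu : u ∈ algSum A₁ A₂)
    (hsign : ∀ i : Fin m,
      f (x i) - u (x i) = (-1 : ℝ) ^ ((i : ℕ) + 1) * |f (x i) - u (x i)|) :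
    (⨅ i : Fin m, |f (x i) - u (x i)|) ≤ approxError A₁ A₂ f := by
  have hm : (0 : ℝ) < m := Nat.cast_pos.mpr hx.1
  have : Nonempty (algSum A₁ A₂) := ⟨⟨u, hu⟩⟩
  refine le_ciInf fun v => ?_
  have hinf (i : Fin m) : (⨅ i : Fin m, |f (x i) - u (x i)|) ≤ |f (x i) - u (x i)| :=
    ciInf_le (Set.finite_range _).bddBelow i
  have habs (i : Fin m) : |f (x i) - u (x i)| = -((-1 : ℝ) ^ (i : ℕ) * (f (x i) - u (x i))) := by
    have hsq : (-1 : ℝ) ^ (i : ℕ) * (-1 : ℝ) ^ (i : ℕ) = 1 := by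
      rw [← mul_pow]; norm_num
    have := hsign i
    rw [pow_succ] at this
    linear_combination (-1 : ℝ) ^ (i : ℕ) * this - |f (x i) - u (x i)| * hsq
  have hterm (i : Fin m) :
      -((-1 : ℝ) ^ (i : ℕ) * (f (x i) - (v : C(X, ℝ)) (x i))) ≤ ‖f - (v : C(X, ℝ))‖ := by
    calc _ ≤ |-((-1 : ℝ) ^ (i : ℕ) * (f (x i) - (v : C(X, ℝ)) (x i)))| := le_abs_self _
      _ = ‖(f - (v : C(X, ℝ))) (x i)‖ := by
        rw [abs_neg, abs_mul, abs_neg_one_pow, one_mul, ContinuousMap.sub_apply, Real.norm_eq_abs]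
      _ ≤ _ := ContinuousMap.norm_coe_le_norm _ _
  have hsum : ∑ i : Fin m, |f (x i) - u (x i)| =
      ∑ i : Fin m, -((-1 : ℝ) ^ (i : ℕ) * (f (x i) - (v : C(X, ℝ)) (x i))) := by
    have h1 := hx.sum_eq_zero hu
    have h2 := hx.sum_eq_zero v.2
    simp only [habs, mul_sub, Finset.sum_neg_distrib, Finset.sum_sub_distrib, h1, h2]
  have hlow := Finset.card_nsmul_le_sum Finset.univ _ _ fun i _ => hinf i
  have hupp := Finset.sum_le_card_nsmul Finset.univ _ _ fun i _ => hterm i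
  rw [hsum] at hlow
  have := hlow.trans hupp
  simp only [Finset.card_univ, Fintype.card_fin, nsmul_eq_mul] at this
  exact le_of_mul_le_mul_left this hm
end

section
/- Let X be a compact metric space, let A₁ and A₂ be closed subalgebras of C(X) containing the constants, and let f ∈ C(X). Suppose {x₁, x₂, x₃, ...} is an infinite bolt with respect to A₁ and A₂, and u ∈ A₁ + A₂ is a function such that f(x_i) − u(x_i) = (−1)^i |f(x_i) − u(x_i)| for all i = 1, 2, .... Then E(f) ≥ inf_{i ≥ 1} |f(x_i) − u(x_i)|. -/
open Filter Topology

/-- If `g` links each even index to its successor and `h` each odd index to its successor,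
then an alternating sum of `g + h` over an even number of terms telescopes. -/
lemma sum_range_alternating_eq_of_linked {X : Type*} (g h : X → ℝ) (x : ℕ → X)
    (hg : ∀ i, Even i → g (x i) = g (x (i + 1)))
    (hh : ∀ i, ¬ Even i → h (x i) = h (x (i + 1))) (k : ℕ) :
    ∑ i ∈ Finset.range (2 * k), (-1 : ℝ) ^ (i + 1) * (g (x i) + h (x i)) =
      h (x (2 * k)) - h (x 0) := by
  induction k with
  | zero => simp
  | succ k ih =>
    have h₁ := hg (2 * k) (by simp)
    have h₂ := hh (2 * k + 1) (by simp)
    rw [show 2 * (k + 1) = 2 * k + 1 + 1 by ring, Finset.sum_range_succ,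
      Finset.sum_range_succ, ih, ← h₂, ← h₁]
    simp only [pow_succ, pow_mul]
    ring_nf

/-- The alternating sums of an element of `A₁ + A₂` along an infinite bolt are bounded. -/
lemma IsInfiniteBolt.exists_abs_sum_le {X : Type*} [TopologicalSpace X] [CompactSpace X]
    {A₁ A₂ : Subalgebra ℝ C(X, ℝ)} {x : ℕ → X} (hx : IsInfiniteBolt A₁ A₂ x)
    {w : C(X, ℝ)} (hw : w ∈ algSum A₁ A₂) :
    ∃ C : ℝ, ∀ k : ℕ, |∑ i ∈ Finset.range (2 * k), (-1 : ℝ) ^ (i + 1) * w (x i)| ≤ C := by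
  have bound (h : C(X, ℝ)) (a b : X) : |h a - h b| ≤ ‖h‖ + ‖h‖ :=
    (abs_sub _ _).trans (add_le_add (h.norm_coe_le_norm a) (h.norm_coe_le_norm b))
  obtain ⟨g, hg, h, hh, rfl⟩ := hw
  obtain ⟨-, hl | hl⟩ := hx
  · refine ⟨‖h‖ + ‖h‖, fun k => ?_⟩
    have key := sum_range_alternating_eq_of_linked g h x
      (fun i hi => by have := hl i; rw [if_pos hi] at this; exact this g hg)
      (fun i hi => by have := hl i; rw [if_neg hi] at this; exact this h hh) k
    simp only [ContinuousMap.add_apply]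
    rw [key]
    exact bound _ _ _
  · refine ⟨‖g‖ + ‖g‖, fun k => ?_⟩
    have key := sum_range_alternating_eq_of_linked h g x
      (fun i hi => by have := hl i; rw [if_pos hi] at this; exact this h hh)
      (fun i hi => by have := hl i; rw [if_neg hi] at this; exact this g hg) k
    simp only [ContinuousMap.add_apply, add_comm (g _)]
    rw [key]
    exact bound _ _ _

lemma sub_mem_algSum {X : Type*} [TopologicalSpace X] {A₁ A₂ : Subalgebra ℝ C(X, ℝ)}
    {v u : C(X, ℝ)} (hv : v ∈ algSum A₁ A₂) (hu : u ∈ algSum A₁ A₂) :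
    v - u ∈ algSum A₁ A₂ := by
  obtain ⟨v₁, hv₁, v₂, hv₂, rfl⟩ := hv
  obtain ⟨u₁, hu₁, u₂, hu₂, rfl⟩ := hu
  exact ⟨v₁ - u₁, sub_mem hv₁ hu₁, v₂ - u₂, sub_mem hv₂ hu₂, add_sub_add_comm _ _ _ _⟩

theorem deLaValleePoussin_infiniteBolt {X : Type*} [MetricSpace X] [CompactSpace X]
    (A₁ A₂ : Subalgebra ℝ C(X, ℝ))
    (hA₁ : IsClosed (A₁ : Set C(X, ℝ))) (hA₂ : IsClosed (A₂ : Set C(X, ℝ)))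
    (f : C(X, ℝ)) (x : ℕ → X) (hx : IsInfiniteBolt A₁ A₂ x)
    (u : C(X, ℝ)) (hu : u ∈ algSum A₁ A₂)
    (hsign : ∀ i : ℕ,
      f (x i) - u (x i) = (-1 : ℝ) ^ (i + 1) * |f (x i) - u (x i)|) :
    (⨅ i : ℕ, |f (x i) - u (x i)|) ≤ approxError A₁ A₂ f := by
  have : Nonempty (algSum A₁ A₂) := ⟨⟨u, hu⟩⟩
  refine le_ciInf fun ⟨v, hv⟩ => ?_
  obtain ⟨C, hC⟩ := hx.exists_abs_sum_le (sub_mem_algSum hv hu)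
  set m := ⨅ i : ℕ, |f (x i) - u (x i)|
  have hm (i : ℕ) : m ≤ |f (x i) - u (x i)| :=
    ciInf_le ⟨0, by rintro _ ⟨i, rfl⟩; exact abs_nonneg _⟩ i
  have hterm (i : ℕ) : m - ‖f - v‖ ≤ (-1 : ℝ) ^ (i + 1) * (v - u) (x i) := by
    have hfv : |f (x i) - v (x i)| ≤ ‖f - v‖ := (f - v).norm_coe_le_norm (x i)
    have hi := hm i
    have hs := hsign i
    rw [ContinuousMap.sub_apply]
    rw [abs_le] at hfv
    rcases neg_one_pow_eq_or ℝ (i + 1) with h | h <;> rw [h] at hs ⊢ <;> linarith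
  change m ≤ ‖f - v‖
  by_contra! hlt
  obtain ⟨k, hk⟩ := exists_nat_gt (C / (m - ‖f - v‖))
  rw [div_lt_iff₀ (sub_pos.2 hlt)] at hk
  have hsum := Finset.card_nsmul_le_sum (Finset.range (2 * k)) _ _ fun i _ => hterm i
  rw [Finset.card_range, nsmul_eq_mul] at hsum
  rw [Nat.cast_mul, Nat.cast_ofNat] at hsum
  have hle := (le_abs_self _).trans (hC k)
  have hnonneg := mul_nonneg k.cast_nonneg (sub_pos.2 hlt).le
  linarith
end

section
/- Let X be a compact metric space, let A₁ and A₂ be closed subalgebras of C(X) containing the constants, and suppose A₁ + A₂ is proximinal in C(X). Then for every f ∈ C(X) \ (A₁ + A₂), the approximation error satisfies E(f) = sup_l |r_l(f)|, where the supremum is taken over all closed bolts l ⊂ X with respect to A₁ and A₂. -/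
open Filter Topology

/-- The set of all points linked via `A` to some point of `S`. -/
def linkSaturation {X : Type*} [TopologicalSpace X] (A : Subalgebra ℝ C(X, ℝ)) (S : Set X) :
    Set X :=
  {y | ∃ x ∈ S, AlgLink A x y}

/-- The sequence of algebras `A, B, A, B, ...`. -/
def alternate {α : Type*} (A B : α) (k : ℕ) : α := if Even k then A else B

/-- The points that end a chain `x 0, ..., x k` with `x i ∈ R i` for all `i` and with
`x i` linked to `x (i + 1)` via `L i`. -/
def chainEnds {X : Type*} [TopologicalSpace X] (L : ℕ → Subalgebra ℝ C(X, ℝ)) (R : ℕ → Set X) :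
    ℕ → Set X
  | 0 => R 0
  | k + 1 => linkSaturation (L k) (chainEnds L R k) ∩ R (k + 1)

/-- `x 0, ..., x m = x 0` is a cycle of even length whose links alternate between `A` and `B`;
consecutive points may coincide. -/
def IsWeakCycle {X : Type*} [TopologicalSpace X] (A B : Subalgebra ℝ C(X, ℝ)) (m : ℕ)
    (x : ℕ → X) : Prop :=
  Even m ∧ (∀ i < m, AlgLink (alternate A B i) (x i) (x (i + 1))) ∧ x m = x 0

section Alternate

variable {α : Type*} (A B : α)

@[simp] lemma alternate_zero : alternate A B 0 = A := by simp [alternate]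

lemma alternate_succ (k : ℕ) : alternate A B (k + 1) = alternate B A k := by
  by_cases h : Even k <;> simp [alternate, Nat.even_add_one, h]

lemma alternate_add_two (k : ℕ) : alternate A B (k + 2) = alternate A B k := by
  rw [alternate_succ, alternate_succ]

lemma alternate_even_add {k : ℕ} (hk : Even k) (j : ℕ) :
    alternate A B (k + j) = alternate A B j := by
  simp [alternate, Nat.even_add, hk]

lemma alternate_of_even {k : ℕ} (hk : Even k) : alternate A B k = A := if_pos hk

end Alternate

section Links

variable {X : Type*} [TopologicalSpace X] {A B : Subalgebra ℝ C(X, ℝ)}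

lemma AlgLink.trans {a b c : X} (h : AlgLink A a b) (h' : AlgLink A b c) : AlgLink A a c :=
  fun g hg => (h g hg).trans (h' g hg)

lemma isClosed_linkSaturation [CompactSpace X] {S : Set X} (hS : IsClosed S) :
    IsClosed (linkSaturation A S) := by
  have hc : IsClosed {p : X × X | p.1 ∈ S ∧ AlgLink A p.1 p.2} := by
    have : {p : X × X | p.1 ∈ S ∧ AlgLink A p.1 p.2} =
        (Prod.fst ⁻¹' S) ∩ ⋂ g ∈ A, {p : X × X | g p.1 = g p.2} := by
      ext p
      simp [AlgLink]
    rw [this]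
    refine (hS.preimage continuous_fst).inter (isClosed_biInter fun g _ => ?_)
    exact isClosed_eq (by fun_prop) (by fun_prop)
  convert isClosedMap_snd_of_compactSpace _ hc using 1
  ext y
  simp [linkSaturation]

lemma isClosed_chainEnds [CompactSpace X] (L : ℕ → Subalgebra ℝ C(X, ℝ)) {R : ℕ → Set X}
    (hR : ∀ k, IsClosed (R k)) (k : ℕ) : IsClosed (chainEnds L R k) := by
  induction k with
  | zero => exact hR 0
  | succ k ih => exact (isClosed_linkSaturation ih).inter (hR (k + 1))

lemma exists_chain_of_mem_chainEnds {L : ℕ → Subalgebra ℝ C(X, ℝ)} {R : ℕ → Set X} {k : ℕ}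
    {y : X} (hy : y ∈ chainEnds L R k) :
    ∃ x : ℕ → X, x k = y ∧ (∀ i ≤ k, x i ∈ R i) ∧ ∀ i < k, AlgLink (L i) (x i) (x (i + 1)) := by
  induction k generalizing y with
  | zero =>
    refine ⟨fun _ => y, rfl, fun i hi => ?_, fun i hi => absurd hi (Nat.not_lt_zero i)⟩
    obtain rfl : i = 0 := by omega
    exact hy
  | succ k ih =>
    obtain ⟨⟨w, hw, hwy⟩, hyR⟩ := hy
    obtain ⟨x, hxk, hxR, hxL⟩ := ih hw
    refine ⟨fun i => if i ≤ k then x i else y, by simp, fun i hi => ?_, fun i hi => ?_⟩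
    · by_cases h : i ≤ k
      · simpa [h] using hxR i h
      · obtain rfl : i = k + 1 := by omega
        simpa using hyR
    · by_cases h : i < k
      · simpa [h.le, Nat.succ_le_of_lt h] using hxL i h
      · obtain rfl : i = k := by omega
        simpa [hxk] using hwy

end Links

section Separation

lemma exists_mem_eq_two_eq_neg_one {X : Type*} [TopologicalSpace X]
    {A : Subalgebra ℝ C(X, ℝ)} {a b : X} (h : ¬ AlgLink A a b) :
    ∃ g ∈ A, g a = 2 ∧ g b = -1 := by
  simp only [AlgLink, not_forall] at h
  obtain ⟨g, hg, hab⟩ := h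
  refine ⟨(3 / (g a - g b)) • (g - algebraMap ℝ C(X, ℝ) (g b)) - algebraMap ℝ C(X, ℝ) 1,
    A.sub_mem (A.smul_mem (A.sub_mem hg (A.algebraMap_mem _)) _) (A.algebraMap_mem _), ?_, ?_⟩
  · have : g a - g b ≠ 0 := sub_ne_zero.mpr hab
    simp
    field_simp
    norm_num
  · simp

variable {X : Type*} [TopologicalSpace X] [CompactSpace X] {A : Subalgebra ℝ C(X, ℝ)}

/-- A closed algebra of continuous functions separates disjoint closed sets between which
there are no links; the separating function is constant near one of the sets. -/
lemma exists_mem_eq_one_eq_zero (hA : IsClosed (A : Set C(X, ℝ))) {K T : Set X}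
    (hK : IsClosed K) (hT : IsClosed T) (hKT : ∀ a ∈ K, ∀ b ∈ T, ¬ AlgLink A a b) :
    ∃ φ ∈ A, ∃ D : Set X, IsClosed D ∧ (∀ x ∈ K, x ∉ D) ∧ (∀ x, 0 ≤ φ x) ∧ (∀ x, φ x ≤ 1) ∧
      (∀ x ∉ D, φ x = 1) ∧ ∀ x ∈ T, φ x = 0 := by
  have hpt : ∀ a ∈ K, ∃ g ∈ A, g a = 2 ∧ ∀ b ∈ T, g b ≤ 0 := by
    intro a ha
    refine hT.isCompact.induction_on (p := fun S => ∃ g ∈ A, g a = 2 ∧ ∀ b ∈ S, g b ≤ 0)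
      ⟨algebraMap ℝ C(X, ℝ) 2, A.algebraMap_mem _, by simp, by simp⟩ ?_ ?_ ?_
    · rintro S S' hS ⟨g, hg, hga, hgS⟩
      exact ⟨g, hg, hga, fun b hb => hgS b (hS hb)⟩
    · rintro S S' ⟨g, hg, hga, hgS⟩ ⟨g', hg', hga', hgS'⟩
      refine ⟨g ⊓ g', ContinuousMap.inf_mem_closed_subalgebra A hA ⟨g, hg⟩ ⟨g', hg'⟩,
        by simp [hga, hga'], ?_⟩
      rintro b (hb | hb)
      · exact inf_le_left.trans (hgS b hb)
      · exact inf_le_right.trans (hgS' b hb)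
    · intro b hb
      obtain ⟨g, hg, hga, hgb⟩ := exists_mem_eq_two_eq_neg_one (hKT a ha b hb)
      refine ⟨{x | g x < 0}, mem_nhdsWithin_of_mem_nhds
        ((isOpen_lt (by fun_prop) (by fun_prop)).mem_nhds (by simp [hgb])), g, hg, hga,
        fun x hx => le_of_lt hx⟩
  have hsep : ∃ g ∈ A, (∀ a ∈ K, 1 < g a) ∧ ∀ b ∈ T, g b ≤ 0 := by
    refine hK.isCompact.induction_on
      (p := fun S => ∃ g ∈ A, (∀ a ∈ S, 1 < g a) ∧ ∀ b ∈ T, g b ≤ 0)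
      ⟨0, A.zero_mem, by simp, by simp⟩ ?_ ?_ ?_
    · rintro S S' hS ⟨g, hg, hgS, hgT⟩
      exact ⟨g, hg, fun b hb => hgS b (hS hb), hgT⟩
    · rintro S S' ⟨g, hg, hgS, hgT⟩ ⟨g', hg', hgS', hgT'⟩
      refine ⟨g ⊔ g', ContinuousMap.sup_mem_closed_subalgebra A hA ⟨g, hg⟩ ⟨g', hg'⟩, ?_,
        fun b hb => sup_le (hgT b hb) (hgT' b hb)⟩
      rintro a (ha | ha)
      · exact (hgS a ha).trans_le le_sup_left
      · exact (hgS' a ha).trans_le le_sup_right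
    · intro a ha
      obtain ⟨g, hg, hga, hgT⟩ := hpt a ha
      refine ⟨{x | 1 < g x}, mem_nhdsWithin_of_mem_nhds
        ((isOpen_lt (by fun_prop) (by fun_prop)).mem_nhds (by simp [hga])), g, hg,
        fun x hx => hx, hgT⟩
  obtain ⟨g, hg, hgK, hgT⟩ := hsep
  have hg0 : g ⊔ 0 ∈ A := ContinuousMap.sup_mem_closed_subalgebra A hA ⟨g, hg⟩ 0
  refine ⟨(g ⊔ 0) ⊓ 1, ContinuousMap.inf_mem_closed_subalgebra A hA ⟨_, hg0⟩ 1,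
    {x | g x ≤ 1}, isClosed_le (by fun_prop) (by fun_prop), ?_, ?_, ?_, ?_, ?_⟩
  · intro x hx
    simpa using hgK x hx
  · intro x
    simp
  · intro x
    simp
  · intro x hx
    have : 1 < g x := by simpa using hx
    simp [this.le]
  · intro x hx
    simp [hgT x hx]

end Separation

section Cycles

variable {X : Type*} [TopologicalSpace X] {A B : Subalgebra ℝ C(X, ℝ)}

lemma IsWeakCycle.sum_eq_zero_of_mem {m : ℕ} {x : ℕ → X} (hx : IsWeakCycle A B m x)
    {u : C(X, ℝ)} (hu : u ∈ algSum A B) :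
    ∑ i ∈ Finset.range m, (-1 : ℝ) ^ i * u (x i) = 0 := by
  obtain ⟨⟨q, rfl⟩, hL, hclose⟩ := hx
  obtain ⟨g, hg, k, hk, rfl⟩ := hu
  have key : ∀ j ≤ q, ∑ i ∈ Finset.range (j + j), (-1 : ℝ) ^ i * (g + k) (x i) =
      k (x 0) - k (x (j + j)) := by
    intro j
    induction j with
    | zero => simp
    | succ j ih =>
      intro hj
      have h1 := hL (j + j) (by omega)
      have h2 := hL (j + j + 1) (by omega)
      rw [alternate_of_even _ _ ⟨j, rfl⟩] at h1
      rw [alternate_succ, alternate_of_even _ _ ⟨j, rfl⟩] at h2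
      have e : j + 1 + (j + 1) = j + j + 1 + 1 := by omega
      rw [e, Finset.sum_range_succ, Finset.sum_range_succ, ih (by omega), ← h2 k hk,
        pow_succ, Even.neg_one_pow ⟨j, rfl⟩]
      simp only [ContinuousMap.add_apply, h1 g hg]
      ring
  rw [key q le_rfl, hclose, sub_self]

lemma IsWeakCycle.isClosedBolt {m : ℕ} {x : ℕ → X} (hx : IsWeakCycle A B m x) (hm : 0 < m)
    (hne : ∀ i < m, x i ≠ x (i + 1)) : IsClosedBolt A B (fun i : Fin m => x i) := by
  obtain ⟨hev, hL, hclose⟩ := hx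
  have hnext : ∀ i : Fin m, x (nextIdx i) = x (i + 1) := by
    intro i
    rcases Nat.lt_or_ge (i + 1) m with h | h
    · simp [nextIdx, Nat.mod_eq_of_lt h]
    · have : (i : ℕ) + 1 = m := by omega
      simp [nextIdx, this, hclose]
  refine ⟨hm, hev, fun i => ?_, Or.inl fun i => ?_⟩
  · simpa only [hnext] using hne i i.2
  · have := hL i i.2
    simp only [hnext]
    by_cases hi : Even (i : ℕ) <;> simpa [alternate, hi] using this

lemma IsClosedBolt.symm {m : ℕ} {x : Fin m → X} (hx : IsClosedBolt A B x) :
    IsClosedBolt B A x :=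
  ⟨hx.1, hx.2.1, hx.2.2.1, hx.2.2.2.symm⟩

lemma IsClosedBolt.sum_eq_zero_of_mem {m : ℕ} {x : Fin m → X} (hx : IsClosedBolt A B x)
    {u : C(X, ℝ)} (hu : u ∈ algSum A B) :
    ∑ i : Fin m, (-1 : ℝ) ^ (i : ℕ) * u (x i) = 0 := by
  obtain ⟨hm, hev, -, hL⟩ := hx
  set y : ℕ → X := fun i => x ⟨i % m, Nat.mod_lt _ hm⟩ with hy
  have hyx : ∀ i : Fin m, y i = x i := fun i => by simp [hy, Nat.mod_eq_of_lt i.2]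
  have hyn : ∀ i : Fin m, y (i + 1) = x (nextIdx i) := fun i => rfl
  have hsum : ∑ i : Fin m, (-1 : ℝ) ^ (i : ℕ) * u (x i) =
      ∑ i ∈ Finset.range m, (-1 : ℝ) ^ i * u (y i) := by
    rw [Finset.sum_range]
    simp [hyx]
  have hclose : y m = y 0 := by simp [hy]
  rw [hsum]
  rcases hL with hL | hL
  · refine IsWeakCycle.sum_eq_zero_of_mem (A := A) (B := B) ⟨hev, fun i hi => ?_, hclose⟩ hu
    have := hL ⟨i, hi⟩
    rw [← hyn, ← hyx] at this
    by_cases h : Even i <;> simpa [alternate, h] using this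
  · obtain ⟨a, ha, b, hb, rfl⟩ := hu
    refine IsWeakCycle.sum_eq_zero_of_mem (A := B) (B := A) ⟨hev, fun i hi => ?_, hclose⟩
      ⟨b, hb, a, ha, add_comm a b⟩
    have := hL ⟨i, hi⟩
    rw [← hyn, ← hyx] at this
    by_cases h : Even i <;> simpa [alternate, h] using this

/-- Starting a cycle at its second point. -/
lemma IsWeakCycle.rotate {m : ℕ} {x : ℕ → X} (hx : IsWeakCycle A B m x) (hm : 0 < m) :
    IsWeakCycle B A m (fun i => if i < m then x (i + 1) else x 1) := by
  obtain ⟨hev, hL, hclose⟩ := hx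
  refine ⟨hev, fun i hi => ?_, by simp [hm]⟩
  rcases Nat.lt_or_ge (i + 1) m with h | h
  · have := hL (i + 1) h
    rw [alternate_succ] at this
    simpa [hi, h] using this
  · obtain rfl : i + 1 = m := by omega
    have := hL 0 hm
    have hi' : ¬ Even i := by simpa [Nat.even_add_one] using hev
    simp only [alternate, hi', Even.zero, if_true, if_false, zero_add] at this ⊢
    rwa [if_pos hi, if_neg (lt_irrefl _), hclose]

lemma IsWeakCycle.sum_rotate {m : ℕ} {x : ℕ → X} (hx : IsWeakCycle A B m x) (F : C(X, ℝ)) :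
    ∑ i ∈ Finset.range m, (-1 : ℝ) ^ i * F (if i < m then x (i + 1) else x 1) =
      -∑ i ∈ Finset.range m, (-1 : ℝ) ^ i * F (x i) := by
  obtain ⟨hev, -, hclose⟩ := hx
  have h1 : ∑ i ∈ Finset.range m, (-1 : ℝ) ^ i * F (if i < m then x (i + 1) else x 1) =
      ∑ i ∈ Finset.range m, (-1 : ℝ) ^ i * F (x (i + 1)) :=
    Finset.sum_congr rfl fun i hi => by rw [if_pos (Finset.mem_range.mp hi)]
  have h2 := Finset.sum_range_succ (fun i => (-1 : ℝ) ^ i * F (x i)) m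
  rw [Finset.sum_range_succ', hclose, hev.neg_one_pow] at h2
  simp only [pow_zero, pow_succ, mul_neg, mul_one, neg_mul, Finset.sum_neg_distrib] at h2
  rw [h1]
  linarith

/-- A cycle whose first two points coincide can be shortened by two points. -/
lemma IsWeakCycle.dropTwo {m : ℕ} {x : ℕ → X} (hx : IsWeakCycle A B (m + 2) x)
    (h01 : x 0 = x 1) : IsWeakCycle A B m (fun i => if i < m then x (i + 2) else x 2) := by
  obtain ⟨hev, hL, hclose⟩ := hx
  have hev' : Even m := by simpa [Nat.even_add] using hev
  refine ⟨hev', fun i hi => ?_, by by_cases h : 0 < m <;> simp [h]⟩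
  have hi2 := hL (i + 2) (by omega)
  rw [alternate_add_two] at hi2
  rcases Nat.lt_or_ge (i + 1) m with h | h
  · simpa [hi, h, add_right_comm] using hi2
  · obtain rfl : i + 1 = m := by omega
    have hiodd : ¬ Even i := by simpa [Nat.even_add_one] using hev'
    have h1 := hL 1 (by omega)
    have e : x (i + 2 + 1) = x 1 := by
      rw [← h01, ← hclose]
    rw [e] at hi2
    simp only [alternate, hiodd, if_false, Nat.not_even_one] at hi2 h1
    simpa [alternate, hiodd] using hi2.trans h1

/-- A bound for the bolt functionals of all closed bolts controls the alternating sums along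
all cycles, including those with repeated consecutive points. -/
lemma IsWeakCycle.abs_sum_le {F : C(X, ℝ)} {σ : ℝ} (hσ : 0 ≤ σ)
    (hbolt : ∀ (m : ℕ) (x : Fin m → X), IsClosedBolt A B x → |boltFun x F| ≤ σ)
    {m : ℕ} {x : ℕ → X} (hx : IsWeakCycle A B m x) :
    |∑ i ∈ Finset.range m, (-1 : ℝ) ^ i * F (x i)| ≤ m * σ := by
  induction m using Nat.strong_induction_on generalizing x A B with
  | _ m ih =>
    by_cases hne : ∀ i < m, x i ≠ x (i + 1)
    · rcases Nat.eq_zero_or_pos m with rfl | hm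
      · simp
      have hm' : (0 : ℝ) < m := by exact_mod_cast hm
      have := hbolt m _ (hx.isClosedBolt hm hne)
      rw [boltFun, abs_mul, abs_inv, Nat.abs_cast, inv_mul_le_iff₀ hm'] at this
      rwa [Finset.sum_range]
    · push Not at hne
      obtain ⟨j, hj, hxj⟩ := hne
      induction j generalizing x A B with
      | zero =>
        obtain ⟨n, rfl⟩ : ∃ n, m = n + 2 := by
          obtain ⟨q, hq⟩ := hx.1
          exact ⟨m - 2, by omega⟩
        have hn := ih n (by omega) hbolt (hx.dropTwo hxj)
        have hs : ∑ i ∈ Finset.range n, (-1 : ℝ) ^ i * F (if i < n then x (i + 2) else x 2) =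
            ∑ i ∈ Finset.range (n + 2), (-1 : ℝ) ^ i * F (x i) := by
          rw [Finset.sum_range_succ', Finset.sum_range_succ']
          simp only [zero_add] at hxj
          simp only [zero_add, pow_zero, one_mul, neg_one_mul, hxj, pow_succ, mul_neg,
            mul_one, neg_neg, neg_add_cancel_right]
          exact Finset.sum_congr rfl fun i hi => by rw [if_pos (Finset.mem_range.mp hi)]
        rw [hs] at hn
        push_cast
        linarith
      | succ j ihj =>
        have h := ihj (fun m x hx => hbolt m x hx.symm) (hx.rotate (by omega))
          (by omega) (by simpa [hj, Nat.lt_of_succ_lt hj] using hxj)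
        rwa [hx.sum_rotate, abs_neg] at h

end Cycles

section ClosedSum

lemma algSum_eq_sup {X : Type*} [TopologicalSpace X] (A B : Subalgebra ℝ C(X, ℝ)) :
    algSum A B = (A.toSubmodule ⊔ B.toSubmodule : Submodule ℝ C(X, ℝ)) := by
  ext u
  simp only [algSum, Set.mem_ofPred_eq, SetLike.mem_coe, Submodule.mem_sup,
    Subalgebra.mem_toSubmodule]
  simp only [eq_comm]

variable {X : Type*} [TopologicalSpace X] [CompactSpace X] {A B : Subalgebra ℝ C(X, ℝ)}

lemma approxError_le {f u : C(X, ℝ)} (hu : u ∈ algSum A B) : approxError A B f ≤ ‖f - u‖ :=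
  ciInf_le (f := fun u : algSum A B => ‖f - (u : C(X, ℝ))‖)
    ⟨0, by rintro _ ⟨u, rfl⟩; exact norm_nonneg _⟩ ⟨u, hu⟩

lemma isClosed_algSum_of_proximinal
    (hprox : ∀ g : C(X, ℝ), ∃ u ∈ algSum A B, ‖g - u‖ = approxError A B g) :
    IsClosed (algSum A B) := by
  refine isClosed_of_closure_subset fun g hg => ?_
  obtain ⟨u, hu, hgu⟩ := hprox g
  have h0 : ‖g - u‖ ≤ 0 := by
    refine le_of_forall_pos_le_add fun ε hε => ?_
    obtain ⟨w, hw, hgw⟩ := Metric.mem_closure_iff.mp hg ε hε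
    rw [dist_eq_norm] at hgw
    rw [hgu, zero_add]
    exact (approxError_le hw).trans hgw.le
  have : g = u := sub_eq_zero.mp (norm_le_zero_iff.mp h0)
  exact this ▸ hu

/-- If the sum of two closed algebras is closed, its elements have representations with
controlled summands. -/
lemma exists_bounded_representation (hA : IsClosed (A : Set C(X, ℝ)))
    (hB : IsClosed (B : Set C(X, ℝ))) (hAB : IsClosed (algSum A B)) :
    ∃ C : ℝ, ∀ u ∈ algSum A B, ∃ a ∈ A, ∃ b ∈ B, u = a + b ∧ ‖a‖ ≤ C * ‖u‖ := by
  rw [algSum_eq_sup] at *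
  let M := A.toSubmodule
  let N := B.toSubmodule
  have : CompleteSpace M := IsClosed.completeSpace_coe (hs := hA)
  have : CompleteSpace N := IsClosed.completeSpace_coe (hs := hB)
  have : CompleteSpace (M ⊔ N : Submodule ℝ C(X, ℝ)) := IsClosed.completeSpace_coe (hs := hAB)
  let S : (M × N) →L[ℝ] (M ⊔ N : Submodule ℝ C(X, ℝ)) :=
    (M.subtypeL.coprod N.subtypeL).codRestrict (M ⊔ N) fun p =>
      Submodule.add_mem_sup p.1.2 p.2.2
  have hS : Function.Surjective S := by
    rintro ⟨u, hu⟩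
    obtain ⟨a, ha, b, hb, rfl⟩ := Submodule.mem_sup.mp hu
    exact ⟨(⟨a, ha⟩, ⟨b, hb⟩), Subtype.ext rfl⟩
  obtain ⟨C, -, hC⟩ :=
    ContinuousLinearMap.exists_preimage_norm_le (𝕜 := ℝ) (𝕜' := ℝ) (σ := RingHom.id ℝ)
      (E := M × N) (F := (M ⊔ N : Submodule ℝ C(X, ℝ))) S hS
  refine ⟨C, fun u hu => ?_⟩
  obtain ⟨p, hp, hpn⟩ := hC ⟨u, hu⟩
  refine ⟨p.1, p.1.2, p.2, p.2.2, (congrArg Subtype.val hp).symm, ?_⟩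
  exact (norm_fst_le p).trans hpn

end ClosedSum

section Reachability

variable {X : Type*} [MetricSpace X] [CompactSpace X] {A B : Subalgebra ℝ C(X, ℝ)}

/-- If `y` cannot be reached from `x` by `n` alternating links, then some functions in the two
algebras are uniformly close to each other although they vary a lot between `x` and `y`. -/
lemma exists_oscillating_pair (hA : IsClosed (A : Set C(X, ℝ))) (hB : IsClosed (B : Set C(X, ℝ)))
    {R : ℕ → Set X} (hR : ∀ k, IsClosed (R k)) (hRuniv : ∀ k, R (k + 1) = Set.univ) {n : ℕ} {y : X}
    (hy : y ∉ chainEnds (alternate A B) R n) (d k : ℕ) (hk : k + d = n) :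
    ∃ p ∈ alternate A B k, ∃ q ∈ alternate B A k, ∃ D : Set X, IsClosed D ∧
      (∀ z ∈ chainEnds (alternate A B) R k, z ∉ D) ∧ y ∈ D ∧
      (∀ z, 0 ≤ p z - q z ∧ p z - q z ≤ 1) ∧ (∀ z ∉ D, p z = 0 ∧ q z = 0) ∧
      p y + q y = d := by
  induction d generalizing k with
  | zero =>
    obtain rfl : k = n := by omega
    refine ⟨0, zero_mem _, 0, zero_mem _, {y}, isClosed_singleton, ?_, rfl, ?_, ?_, ?_⟩
    · rintro z hz rfl
      exact hy hz
    all_goals simp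
  | succ d ih =>
    obtain ⟨p, hp, q, hq, D, hD, hGD, hyD, hpq, hoff, hsum⟩ := ih (k + 1) (by omega)
    rw [alternate_succ] at hp hq
    have hLk : IsClosed ((alternate A B k : Subalgebra ℝ C(X, ℝ)) : Set C(X, ℝ)) := by
      unfold alternate
      split_ifs <;> assumption
    obtain ⟨φ, hφ, D', hD', hGD', h0, h1, hφ1, hφ0⟩ := exists_mem_eq_one_eq_zero hLk
      (isClosed_chainEnds _ hR k) hD fun a ha b hb hab =>
        hGD b ⟨⟨a, ha, hab⟩, by simp [hRuniv]⟩ hb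
    have hsub : ∀ z ∈ D, z ∈ D' := by
      intro z hz
      by_contra hz'
      linarith [hφ1 z hz', hφ0 z hz]
    refine ⟨(1 - φ) + q, add_mem (sub_mem (one_mem _) hφ) hq, p, hp, D', hD', hGD', hsub y hyD,
      fun z => ?_, fun z hz => ?_, ?_⟩
    · have := hpq z
      by_cases hz : z ∈ D
      · simp only [ContinuousMap.add_apply, ContinuousMap.sub_apply, ContinuousMap.one_apply,
          hφ0 z hz]
        constructor <;> linarith
      · have := hoff z hz
        have := h0 z
        have := h1 z
        simp only [ContinuousMap.add_apply, ContinuousMap.sub_apply, ContinuousMap.one_apply]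
        constructor <;> linarith
    · have := hoff z fun h => hz (hsub z h)
      simp [this, hφ1 z hz]
    · simp only [ContinuousMap.add_apply, ContinuousMap.sub_apply, ContinuousMap.one_apply,
        hφ0 y hyD]
      push_cast
      linarith

/-- If the sum of two closed algebras is closed, then points not separated by the intersection
of the algebras are joined by chains of uniformly bounded length. -/
lemma exists_uniform_chain_length (hA : IsClosed (A : Set C(X, ℝ)))
    (hB : IsClosed (B : Set C(X, ℝ))) (hAB : IsClosed (algSum A B)) :
    ∃ n : ℕ, Even n ∧ ∀ x y : X, (∀ c, c ∈ A → c ∈ B → c x = c y) →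
      ∃ w : ℕ → X, w 0 = x ∧ w n = y ∧
        ∀ i < n, AlgLink (alternate A B i) (w i) (w (i + 1)) := by
  obtain ⟨C, hC⟩ := exists_bounded_representation hA hB hAB
  obtain ⟨N, hN⟩ := exists_nat_gt (4 * |C|)
  refine ⟨N + N, ⟨N, rfl⟩, fun x y hxy => ?_⟩
  let R : ℕ → Set X := fun k => if k = 0 then {x} else Set.univ
  have hR : ∀ k, IsClosed (R k) := by
    intro k
    by_cases h : k = 0 <;> simp [R, h]
  by_cases hy : y ∈ chainEnds (alternate A B) R (N + N)
  · obtain ⟨w, hwy, hwR, hwL⟩ := exists_chain_of_mem_chainEnds hy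
    exact ⟨w, by simpa [R] using hwR 0 (Nat.zero_le _), hwy, hwL⟩
  exfalso
  obtain ⟨p, hp, q, hq, D, -, hGD, -, hpq, hoff, hsum⟩ :=
    exists_oscillating_pair hA hB hR (fun k => by simp [R]) hy (N + N) 0 (zero_add _)
  rw [alternate_zero] at hp hq
  have hxD : x ∉ D := hGD x (by simp [chainEnds, R])
  obtain ⟨a, ha, b, hb, hab, hle⟩ := hC (p - q) ⟨p, hp, -q, neg_mem hq, sub_eq_add_neg p q⟩
  have hnorm : ‖p - q‖ ≤ 1 := by
    refine (ContinuousMap.norm_le _ zero_le_one).mpr fun z => ?_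
    rw [Real.norm_eq_abs, ContinuousMap.sub_apply, abs_of_nonneg (hpq z).1]
    exact (hpq z).2
  have hac : ‖a‖ ≤ |C| := by
    calc ‖a‖ ≤ C * ‖p - q‖ := hle
      _ ≤ |C| * ‖p - q‖ := by gcongr; exact le_abs_self C
      _ ≤ |C| := mul_le_of_le_one_right (abs_nonneg C) hnorm
  have hc := hxy (p - a) (sub_mem hp ha) (by
    have : p - a = q + b := by rw [sub_eq_iff_eq_add] at hab ⊢; rw [hab]; abel
    rw [this]
    exact add_mem hq hb)
  have hax := (abs_le.mp ((Real.norm_eq_abs _).symm.le.trans (a.norm_coe_le_norm x))).1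
  have hay := (abs_le.mp ((Real.norm_eq_abs _).symm.le.trans (a.norm_coe_le_norm y))).2
  simp only [ContinuousMap.sub_apply, (hoff x hxD).1] at hc
  have := (hpq y).1
  push_cast at hsum
  linarith

end Reachability

section Extremal

variable {X : Type*} [MetricSpace X] [CompactSpace X] {A B : Subalgebra ℝ C(X, ℝ)}

/-- If there is no chain of `n` links through the alternating sets `P, Q, P, ...`, then some
element of `A + B` separates these sets. -/
lemma exists_separating_of_no_chain (hA : IsClosed (A : Set C(X, ℝ)))
    (hB : IsClosed (B : Set C(X, ℝ))) {P Q : Set X} (hP : IsClosed P) (hQ : IsClosed Q) {n : ℕ}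
    (hn : chainEnds (alternate A B) (alternate P Q) n = ∅) (d k : ℕ) (hk : k + d = n) :
    ∃ v ∈ A.toSubmodule ⊔ B.toSubmodule, ∃ D : Set X, IsClosed D ∧
      (∀ z ∈ chainEnds (alternate A B) (alternate P Q) k, z ∉ D) ∧
      (∀ z ∈ alternate P Q k, 0 ≤ v z) ∧ (∀ z ∈ alternate P Q k, z ∉ D → 1 ≤ v z) ∧
      ∀ z ∈ alternate Q P k, v z ≤ 0 := by
  have hR : ∀ k, IsClosed (alternate P Q k) := by
    intro k
    unfold alternate
    split_ifs <;> assumption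
  induction d generalizing k with
  | zero =>
    obtain rfl : k = n := by omega
    exact ⟨0, zero_mem _, Set.univ, isClosed_univ, by simp [hn], by simp, by simp, by simp⟩
  | succ d ih =>
    obtain ⟨v, hv, D, hD, hBD, hv0, hv1, hvneg⟩ := ih (k + 1) (by omega)
    have hRk : alternate Q P (k + 1) = alternate P Q k := alternate_succ Q P k
    have hRk' : alternate P Q (k + 1) = alternate Q P k := alternate_succ P Q k
    have hLk : IsClosed ((alternate A B k : Subalgebra ℝ C(X, ℝ)) : Set C(X, ℝ)) := by
      unfold alternate
      split_ifs <;> assumption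
    obtain ⟨φ, hφ, D', hD', hBD', h0, h1, hφ1, hφ0⟩ := exists_mem_eq_one_eq_zero hLk
      (isClosed_chainEnds _ hR k) ((hR (k + 1)).inter hD) fun a ha b hb hab =>
        hBD b ⟨⟨a, ha, hab⟩, hb.1⟩ hb.2
    have hφAB : φ ∈ A.toSubmodule ⊔ B.toSubmodule := by
      unfold alternate at hφ
      split_ifs at hφ
      · exact Submodule.mem_sup_left hφ
      · exact Submodule.mem_sup_right hφ
    rw [hRk] at hvneg
    rw [hRk'] at hv0 hv1 hφ0
    refine ⟨φ - v, sub_mem hφAB hv, D', hD', hBD', fun z hz => ?_, fun z hz hzD => ?_,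
      fun z hz => ?_⟩
    · have := hvneg z hz
      have := h0 z
      simp only [ContinuousMap.sub_apply]
      linarith
    · have := hvneg z hz
      simp only [ContinuousMap.sub_apply, hφ1 z hzD]
      linarith
    · simp only [ContinuousMap.sub_apply]
      by_cases hzD : z ∈ D
      · rw [hφ0 z ⟨hz, hzD⟩]
        linarith [hv0 z hz]
      · linarith [hv1 z hz hzD, h1 z]

/-- A function with the sign of `h` at all points where `|h|` attains the norm of `h` leads to
a better approximation of `h`. -/
lemma exists_norm_sub_smul_lt {h u : C(X, ℝ)} (hh : 0 < ‖h‖)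
    (hu : ∀ x, |h x| = ‖h‖ → 0 < h x * u x) : ∃ t : ℝ, ‖h - t • u‖ < ‖h‖ := by
  have hle : ∀ x, |h x| ≤ ‖h‖ := fun x => h.norm_coe_le_norm x
  have huM : ∀ x, |u x| ≤ ‖u‖ := fun x => u.norm_coe_le_norm x
  obtain ⟨δ, hδ, hδx⟩ : ∃ δ > 0, ∀ x, δ ≤ max (‖h‖ - |h x|) (h x * u x) := by
    rcases isEmpty_or_nonempty X with hX | hX
    · exact ⟨1, one_pos, fun x => (hX.false x).elim⟩
    have hcont : Continuous fun x => max (‖h‖ - |h x|) (h x * u x) := by fun_prop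
    obtain ⟨x₀, -, hx₀⟩ := isCompact_univ.exists_isMinOn Set.univ_nonempty hcont.continuousOn
    refine ⟨_, ?_, fun x => hx₀ (Set.mem_univ x)⟩
    rcases (hle x₀).lt_or_eq with hlt | heq
    · exact lt_max_of_lt_left (sub_pos.mpr hlt)
    · exact lt_max_of_lt_right (hu x₀ heq)
  set M := ‖u‖
  have hM0 : 0 ≤ M := norm_nonneg u
  set t := δ / (1 + M) / (1 + M) with ht
  have h1M : 0 < 1 + M := by linarith
  have ht0 : 0 < t := by positivity
  have htδ : t * (1 + M) * (1 + M) = δ := by rw [ht]; field_simp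
  have htM : t * M < δ := by nlinarith [mul_nonneg ht0.le hM0, mul_nonneg ht0.le (sq_nonneg M)]
  have htM2 : t * M ^ 2 < δ := by nlinarith [mul_nonneg ht0.le hM0]
  refine ⟨t, (ContinuousMap.norm_lt_iff _ hh).mpr fun x => ?_⟩
  rw [Real.norm_eq_abs]
  simp only [ContinuousMap.sub_apply, ContinuousMap.smul_apply, smul_eq_mul]
  rcases le_max_iff.mp (hδx x) with hx | hx
  · calc |h x - t * u x| ≤ |h x| + |t * u x| := abs_sub _ _
      _ ≤ |h x| + t * M := by rw [abs_mul, abs_of_pos ht0]; gcongr; exact huM x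
      _ < ‖h‖ := by linarith
  · refine abs_lt_of_sq_lt_sq ?_ hh.le
    have e1 : h x ^ 2 ≤ ‖h‖ ^ 2 := sq_le_sq' (abs_le.mp (hle x)).1 (abs_le.mp (hle x)).2
    have e2 : u x ^ 2 ≤ M ^ 2 := sq_le_sq' (abs_le.mp (huM x)).1 (abs_le.mp (huM x)).2
    have e3 : t * (t * u x ^ 2) ≤ t * (t * M ^ 2) := by gcongr
    have e4 : t * (t * M ^ 2) < t * δ := by gcongr
    have e5 : t * δ ≤ t * (h x * u x) := by gcongr
    nlinarith

/-- Chebyshev-type property: the error function of a best approximation has alternating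
extremal chains of every length. -/
lemma exists_extremal_chain (hA : IsClosed (A : Set C(X, ℝ))) (hB : IsClosed (B : Set C(X, ℝ)))
    {h : C(X, ℝ)} (hh : 0 < ‖h‖) (hbest : ∀ u ∈ algSum A B, ‖h‖ ≤ ‖h - u‖) (n : ℕ) :
    ∃ x : ℕ → X, (∀ i ≤ n, h (x i) = (-1) ^ i * ‖h‖) ∧
      ∀ i < n, AlgLink (alternate A B i) (x i) (x (i + 1)) := by
  set P : Set X := {x | h x = ‖h‖}
  set Q : Set X := {x | h x = -‖h‖}
  have hP : IsClosed P := isClosed_eq (by fun_prop) (by fun_prop)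
  have hQ : IsClosed Q := isClosed_eq (by fun_prop) (by fun_prop)
  rcases (chainEnds (alternate A B) (alternate P Q) n).eq_empty_or_nonempty with hn | ⟨y, hy⟩
  · exfalso
    obtain ⟨v, hv, D, -, hBD, -, hv1, hvneg⟩ :=
      exists_separating_of_no_chain hA hB hP hQ hn n 0 (zero_add n)
    rw [alternate_zero] at hv1 hvneg
    have hvP : ∀ z ∈ P, 1 ≤ v z := fun z hz => hv1 z hz (hBD z (by simpa [chainEnds] using hz))
    have hc : algebraMap ℝ C(X, ℝ) (1 / 2) ∈ A.toSubmodule ⊔ B.toSubmodule :=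
      Submodule.mem_sup_left (A.algebraMap_mem _)
    obtain ⟨t, ht⟩ := exists_norm_sub_smul_lt (u := v - algebraMap ℝ C(X, ℝ) (1 / 2)) hh
      fun x hx => by
        have e : (v - algebraMap ℝ C(X, ℝ) (1 / 2)) x = v x - 1 / 2 := by simp
        rw [e]
        rcases (abs_eq hh.le).mp hx with hx | hx
        · have := hvP x hx
          rw [hx]
          exact mul_pos hh (by linarith)
        · have := hvneg x hx
          rw [hx]
          exact mul_pos_of_neg_of_neg (by linarith) (by linarith)
    refine absurd ht (not_lt.mpr (hbest _ ?_))
    rw [algSum_eq_sup]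
    exact Submodule.smul_mem _ t (sub_mem hv hc)
  · obtain ⟨x, -, hxR, hxL⟩ := exists_chain_of_mem_chainEnds hy
    refine ⟨x, fun i hi => ?_, hxL⟩
    have := hxR i hi
    by_cases hev : Even i
    · simp only [alternate, hev, if_true] at this
      rw [hev.neg_one_pow, one_mul]
      exact this
    · simp only [alternate, hev, if_false] at this
      rw [(Nat.not_even_iff_odd.mp hev).neg_one_pow, neg_one_mul]
      exact this

end Extremal

section Duality

variable {X : Type*} [TopologicalSpace X] {A B : Subalgebra ℝ C(X, ℝ)}

/-- The concatenation of an even chain with a chain leading back to its starting point. -/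
lemma isWeakCycle_append {p k : ℕ} {x w : ℕ → X} (hp : Even p) (hk : Even k)
    (hx : ∀ i < p, AlgLink (alternate A B i) (x i) (x (i + 1)))
    (hw : ∀ i < k, AlgLink (alternate A B i) (w i) (w (i + 1)))
    (hw0 : w 0 = x p) (hwk : w k = x 0) :
    IsWeakCycle A B (p + k) (fun i => if i < p then x i else w (i - p)) := by
  refine ⟨hp.add hk, fun i hi => ?_, ?_⟩
  · rcases Nat.lt_or_ge i p with h | h
    · rcases Nat.lt_or_ge (i + 1) p with h' | h'
      · simpa [h, h'] using hx i h
      · obtain rfl : i + 1 = p := by omega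
        simpa [hw0] using hx i h
    · obtain ⟨j, rfl⟩ := Nat.exists_eq_add_of_le h
      have h1 : ¬ p + j + 1 < p := by omega
      have h2 : p + j + 1 - p = j + 1 := by omega
      simpa [h1, h2, alternate_even_add _ _ hp] using hw j (by omega)
  · rcases Nat.eq_zero_or_pos p with rfl | h
    · simp [hw0, hwk]
    · simp [h, hwk]

lemma abs_boltFun_le_of_mem [CompactSpace X] {m : ℕ} {x : Fin m → X} (hx : IsClosedBolt A B x)
    {u : C(X, ℝ)} (hu : u ∈ algSum A B) (F : C(X, ℝ)) : |boltFun x F| ≤ ‖F - u‖ := by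
  have hm : (0 : ℝ) < m := by exact_mod_cast hx.1
  have hs : ∑ i : Fin m, (-1 : ℝ) ^ (i : ℕ) * F (x i) =
      ∑ i : Fin m, (-1 : ℝ) ^ (i : ℕ) * (F - u) (x i) := by
    simp only [ContinuousMap.sub_apply, mul_sub, Finset.sum_sub_distrib, hx.sum_eq_zero_of_mem hu,
      sub_zero]
  rw [boltFun, hs, abs_mul, abs_inv, Nat.abs_cast, inv_mul_le_iff₀ hm]
  refine (Finset.abs_sum_le_sum_abs _ _).trans ?_
  calc ∑ i : Fin m, |(-1 : ℝ) ^ (i : ℕ) * (F - u) (x i)| ≤ ∑ _i : Fin m, ‖F - u‖ :=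
        Finset.sum_le_sum fun i _ => by
          rw [abs_mul, abs_neg_one_pow, one_mul]
          exact (F - u).norm_coe_le_norm (x i)
    _ = m * ‖F - u‖ := by simp

end Duality

theorem duality_formula_closedBolts {X : Type*} [MetricSpace X] [CompactSpace X]
    (A₁ A₂ : Subalgebra ℝ C(X, ℝ))
    (hA₁ : IsClosed (A₁ : Set C(X, ℝ))) (hA₂ : IsClosed (A₂ : Set C(X, ℝ)))
    (hprox : ∀ g : C(X, ℝ), ∃ u ∈ algSum A₁ A₂, ‖g - u‖ = approxError A₁ A₂ g)
    (f : C(X, ℝ)) (hf : f ∉ algSum A₁ A₂) :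
    approxError A₁ A₂ f =
      sSup {r : ℝ | ∃ (m : ℕ) (x : Fin m → X), IsClosedBolt A₁ A₂ x ∧ r = |boltFun x f|} := by
  obtain ⟨u, hu, hfu⟩ := hprox f
  set E := approxError A₁ A₂ f
  set T := {r : ℝ | ∃ (m : ℕ) (x : Fin m → X), IsClosedBolt A₁ A₂ x ∧ r = |boltFun x f|}
  have hE0 : 0 < E := by
    rw [← hfu, norm_pos_iff, sub_ne_zero]
    rintro rfl
    exact hf hu
  have hTE : ∀ r ∈ T, r ≤ E := by
    rintro r ⟨m, x, hx, rfl⟩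
    exact hfu ▸ abs_boltFun_le_of_mem hx hu f
  have hσ0 : 0 ≤ sSup T := by
    refine Real.sSup_nonneg ?_
    rintro r ⟨m, x, hx, rfl⟩
    exact abs_nonneg _
  have hbolt : ∀ (m : ℕ) (x : Fin m → X), IsClosedBolt A₁ A₂ x → |boltFun x f| ≤ sSup T :=
    fun m x hx => le_csSup ⟨E, hTE⟩ ⟨m, x, hx, rfl⟩
  refine le_antisymm ?_ (Real.sSup_le hTE hE0.le)
  obtain ⟨k, hk, hreach⟩ := exists_uniform_chain_length hA₁ hA₂
    (isClosed_algSum_of_proximinal hprox)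
  have hbest : ∀ w ∈ algSum A₁ A₂, ‖f - u‖ ≤ ‖f - u - w‖ := by
    intro w hw
    rw [hfu, sub_sub]
    refine approxError_le ?_
    rw [algSum_eq_sup] at *
    exact add_mem hu hw
  have hmain : ∀ p : ℕ, Even p → (p - k : ℝ) * E ≤ (p + k) * sSup T := by
    intro p hp
    obtain ⟨x, hxh, hxL⟩ := exists_extremal_chain hA₁ hA₂ (hfu ▸ hE0) hbest p
    rw [hfu] at hxh
    have hconst : ∀ c, c ∈ A₁ → c ∈ A₂ → c (x p) = c (x 0) := by
      intro c h₁ h₂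
      have : ∀ i ≤ p, c (x i) = c (x 0) := by
        intro i
        induction i with
        | zero => exact fun _ => rfl
        | succ i ih =>
          intro hi
          have hl := hxL i hi
          rw [← ih (by omega)]
          refine (hl c ?_).symm
          unfold alternate
          split_ifs <;> assumption
      exact this p le_rfl
    obtain ⟨w, hw0, hwk, hwL⟩ := hreach (x p) (x 0) hconst
    obtain ⟨z, hz⟩ : ∃ z : ℕ → X, z = fun i => if i < p then x i else w (i - p) := ⟨_, rfl⟩
    have hcyc := isWeakCycle_append hp hk hxL hwL hw0 hwk
    rw [← hz] at hcyc
    have hle := hcyc.abs_sum_le hσ0 hbolt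
    have hzero := hcyc.sum_eq_zero_of_mem hu
    have hs : ∑ i ∈ Finset.range (p + k), (-1 : ℝ) ^ i * f (z i) =
        ∑ i ∈ Finset.range (p + k), (-1 : ℝ) ^ i * (f - u) (z i) := by
      simp only [ContinuousMap.sub_apply, mul_sub, Finset.sum_sub_distrib, hzero, sub_zero]
    have hfirst : ∑ i ∈ Finset.range p, (-1 : ℝ) ^ i * (f - u) (z i) = p * E := by
      rw [Finset.sum_congr rfl fun i hi => ?_, Finset.sum_const, Finset.card_range, nsmul_eq_mul]
      have hi' := Finset.mem_range.mp hi
      rw [hz]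
      simp only [hi', if_true]
      rw [hxh i hi'.le, ← mul_assoc, ← mul_pow]
      simp
    have hlast : -(k * E) ≤
        ∑ i ∈ Finset.range k, (-1 : ℝ) ^ (p + i) * (f - u) (z (p + i)) := by
      have : ∑ _i ∈ Finset.range k, -E ≤
          ∑ i ∈ Finset.range k, (-1 : ℝ) ^ (p + i) * (f - u) (z (p + i)) := by
        refine Finset.sum_le_sum fun i _ => (abs_le.mp ?_).1
        rw [abs_mul, abs_neg_one_pow, one_mul, ← hfu]
        exact (f - u).norm_coe_le_norm _
      simpa using this
    rw [hs, Finset.sum_range_add, hfirst] at hle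
    rw [Nat.cast_add] at hle
    have := (le_abs_self _).trans hle
    linarith
  by_contra! hlt
  obtain ⟨p, hp⟩ := exists_nat_gt (k * (E + sSup T) / (E - sSup T))
  rw [div_lt_iff₀ (sub_pos.mpr hlt)] at hp
  have := hmain (p + p) ⟨p, rfl⟩
  push_cast at this
  have : 0 ≤ (p : ℝ) * (E - sSup T) := mul_nonneg p.cast_nonneg (sub_pos.mpr hlt).le
  linarith
end

section
/- Let X be a compact metric space, let A₁ and A₂ be closed subalgebras of C(X) containing the constants, and let l = {x₁,...,x_n} be a finite bolt with respect to A₁ and A₂. Then the bolt functional r_l has operator norm ‖r_l‖ = 1 if and only if the set of points x_i with odd indices i is disjoint from the set of points x_i with even indices i. -/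
open Filter Topology

theorem abs_sum_alternating_le {X : Type*} [TopologicalSpace X] [CompactSpace X] {n : ℕ}
    (x : Fin n → X) (F : C(X, ℝ)) (s : Finset (Fin n)) :
    |∑ i ∈ s, (-1 : ℝ) ^ (i : ℕ) * F (x i)| ≤ s.card * ‖F‖ := by
  have h : ∀ i ∈ s, ‖(-1 : ℝ) ^ (i : ℕ) * F (x i)‖ ≤ ‖F‖ := fun i _ => by
    simpa using F.norm_coe_le_norm (x i)
  simpa using norm_sum_le_of_le s h

theorem abs_boltFun_le {X : Type*} [TopologicalSpace X] [CompactSpace X] {n : ℕ} (hn : 0 < n)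
    (x : Fin n → X) (F : C(X, ℝ)) : |boltFun x F| ≤ ‖F‖ := by
  have hn' : (0 : ℝ) < n := by exact_mod_cast hn
  have h := abs_sum_alternating_le x F Finset.univ
  rw [Finset.card_univ, Fintype.card_fin] at h
  rwa [boltFun, abs_mul, abs_of_pos (inv_pos.2 hn'), inv_mul_le_iff₀ hn']

/-- If a point occurs both at an even and at an odd index, two terms of the bolt functional
cancel. -/
theorem abs_boltFun_le_of_even_odd {X : Type*} [TopologicalSpace X] [CompactSpace X] {n : ℕ}
    (x : Fin n → X) {i j : Fin n} (hi : Even (i : ℕ)) (hj : Odd (j : ℕ)) (hij : x i = x j)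
    (F : C(X, ℝ)) : |boltFun x F| ≤ (1 - 2 / n) * ‖F‖ := by
  have hn' : (0 : ℝ) < n := by exact_mod_cast i.pos
  have hne : j ≠ i := by
    rintro rfl
    exact Nat.not_even_iff_odd.2 hj hi
  have hmem : j ∈ Finset.univ.erase i := Finset.mem_erase.2 ⟨hne, Finset.mem_univ j⟩
  have hcard₁ := Finset.card_erase_add_one (Finset.mem_univ i)
  have hcard₂ := Finset.card_erase_add_one hmem
  rw [Finset.card_univ, Fintype.card_fin] at hcard₁
  have hcard : ((((Finset.univ.erase i).erase j).card : ℕ) : ℝ) = n - 2 := by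
    have : ((Finset.univ.erase i).erase j).card + 2 = n := by omega
    rw [eq_sub_iff_add_eq]
    exact_mod_cast this
  have hsum : ∑ k : Fin n, (-1 : ℝ) ^ (k : ℕ) * F (x k) =
      ∑ k ∈ (Finset.univ.erase i).erase j, (-1 : ℝ) ^ (k : ℕ) * F (x k) := by
    rw [← Finset.add_sum_erase _ _ (Finset.mem_univ i), ← Finset.add_sum_erase _ _ hmem,
      hi.neg_one_pow, hj.neg_one_pow, hij]
    ring
  have h := abs_sum_alternating_le x F ((Finset.univ.erase i).erase j)
  rw [hcard] at h
  rw [boltFun, hsum, abs_mul, abs_of_pos (inv_pos.2 hn'), inv_mul_le_iff₀ hn']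
  refine h.trans_eq ?_
  rw [← mul_assoc, mul_sub, mul_one, mul_div_cancel₀ _ hn'.ne']

theorem exists_norm_le_one_boltFun_eq_one {X : Type*} [TopologicalSpace X] [CompactSpace X]
    [T2Space X] {n : ℕ} (hn : 0 < n) (x : Fin n → X)
    (hd : Disjoint {p : X | ∃ i : Fin n, Even (i : ℕ) ∧ x i = p}
      {p : X | ∃ i : Fin n, Odd (i : ℕ) ∧ x i = p}) :
    ∃ F : C(X, ℝ), ‖F‖ ≤ 1 ∧ boltFun x F = 1 := by
  have hfin (P : Fin n → Prop) : IsClosed {p : X | ∃ i : Fin n, P i ∧ x i = p} :=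
    ((Set.toFinite {i | P i}).image x).isClosed
  obtain ⟨f, hf₀, hf₁, hf⟩ := exists_continuous_zero_one_of_isClosed
    (hfin fun i => Odd (i : ℕ)) (hfin fun i => Even (i : ℕ)) hd.symm
  refine ⟨f + f - 1, (ContinuousMap.norm_le _ zero_le_one).2 fun p => ?_, ?_⟩
  · obtain ⟨h₀, h₁⟩ := hf p
    simp only [ContinuousMap.sub_apply, ContinuousMap.add_apply,
      ContinuousMap.one_apply, Real.norm_eq_abs, abs_le]
    constructor <;> linarith
  · have h : ∀ i : Fin n, (-1 : ℝ) ^ (i : ℕ) * (f + f - 1 : C(X, ℝ)) (x i) = 1 := fun i => by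
      rcases Nat.even_or_odd (i : ℕ) with hi | hi
      · have : f (x i) = 1 := hf₁ ⟨i, hi, rfl⟩
        simp [hi.neg_one_pow, this]
      · have : f (x i) = 0 := hf₀ ⟨i, hi, rfl⟩
        simp [hi.neg_one_pow, this]
    have hn' : (n : ℝ) ≠ 0 := by exact_mod_cast hn.ne'
    rw [boltFun, Finset.sum_congr rfl fun i _ => h i]
    simp [hn']

theorem boltFunctional_norm_eq_one_iff {X : Type*} [MetricSpace X] [CompactSpace X]
    (A₁ A₂ : Subalgebra ℝ C(X, ℝ))
    (hA₁ : IsClosed (A₁ : Set C(X, ℝ))) (hA₂ : IsClosed (A₂ : Set C(X, ℝ)))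
    {n : ℕ} (hn : 0 < n) (x : Fin n → X) (hx : IsFiniteBolt A₁ A₂ x)
    (T : C(X, ℝ) →L[ℝ] ℝ) (hT : ∀ F : C(X, ℝ), T F = boltFun x F) :
    ‖T‖ = 1 ↔
      Disjoint {p : X | ∃ i : Fin n, Even (i : ℕ) ∧ x i = p}
               {p : X | ∃ i : Fin n, Odd (i : ℕ) ∧ x i = p} := by
  have hle : ‖T‖ ≤ 1 := T.opNorm_le_bound zero_le_one fun F => by
    simpa [hT] using abs_boltFun_le hn x F
  have hn' : (0 : ℝ) < n := by exact_mod_cast hn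
  constructor
  · intro h
    rw [Set.disjoint_left]
    rintro _ ⟨i, hi, rfl⟩ ⟨j, hj, hji⟩
    have hn2 : (2 : ℝ) ≤ n := by
      have := hj.pos
      exact_mod_cast (show 2 ≤ n by omega)
    have hlt : ‖T‖ ≤ 1 - 2 / n :=
      T.opNorm_le_bound (sub_nonneg.2 ((div_le_one hn').2 hn2)) fun F => by
        simpa [hT] using abs_boltFun_le_of_even_odd x hi hj hji.symm F
    have : (0 : ℝ) < 2 / n := by positivity
    linarith
  · intro hd
    obtain ⟨F, hF, hF₁⟩ := exists_norm_le_one_boltFun_eq_one hn x hd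
    refine le_antisymm hle ?_
    have h := T.unit_le_opNorm F hF
    rwa [hT, hF₁, norm_one] at h
end

section
/- Let X be a compact metric space, let A₁ and A₂ be closed subalgebras of C(X) containing the constants, and let f ∈ C(X). Then sup over all closed bolts l ⊂ X of |r_l(f)| is less than or equal to sup over all infinite bolts l = {x₁, x₂, ...} ⊂ X of limsup_{n→∞} |r_{l_n}(f)| (where l_n = {x₁,...,x_n}), which in turn is less than or equal to E(f). -/
open Filter Topology

theorem boltFun_coe {X : Type*} [TopologicalSpace X] (x : ℕ → X) (F : C(X, ℝ)) (n : ℕ) :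
    boltFun (fun i : Fin n => x (i : ℕ)) F =
      (n : ℝ)⁻¹ * ∑ i ∈ Finset.range n, (-1 : ℝ) ^ i * F (x i) := by
  rw [boltFun, Fin.sum_univ_eq_sum_range (fun i => (-1 : ℝ) ^ i * F (x i))]

theorem boltFun_add {X : Type*} [TopologicalSpace X] {n : ℕ} (x : Fin n → X) (F G : C(X, ℝ)) :
    boltFun x (F + G) = boltFun x F + boltFun x G := by
  simp [boltFun, mul_add, Finset.sum_add_distrib]

theorem abs_boltFun_le_norm {X : Type*} [TopologicalSpace X] [CompactSpace X] {n : ℕ}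
    (x : Fin n → X) (F : C(X, ℝ)) : |boltFun x F| ≤ ‖F‖ := by
  have h : |∑ i : Fin n, (-1 : ℝ) ^ (i : ℕ) * F (x i)| ≤ n * ‖F‖ := by
    refine (Finset.abs_sum_le_sum_abs _ _).trans ?_
    refine (Finset.sum_le_card_nsmul _ _ ‖F‖ fun i _ => ?_).trans (by simp)
    simpa [abs_mul] using F.norm_coe_le_norm (x i)
  rw [boltFun, abs_mul, abs_of_nonneg (by positivity : (0 : ℝ) ≤ (n : ℝ)⁻¹)]
  rcases n.eq_zero_or_pos with rfl | hn
  · simp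
  · have hn' : (0 : ℝ) < n := by exact_mod_cast hn
    rwa [inv_mul_le_iff₀ hn']

theorem isBoundedUnder_abs_boltFun {X : Type*} [TopologicalSpace X] [CompactSpace X]
    (x : ℕ → X) (F : C(X, ℝ)) :
    IsBoundedUnder (· ≤ ·) atTop
      (fun n : ℕ => |boltFun (fun i : Fin n => x (i : ℕ)) F|) :=
  isBoundedUnder_of ⟨‖F‖, fun _ => abs_boltFun_le_norm _ F⟩

theorem isCoboundedUnder_abs_boltFun {X : Type*} [TopologicalSpace X]
    (x : ℕ → X) (F : C(X, ℝ)) :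
    IsCoboundedUnder (· ≤ ·) atTop
      (fun n : ℕ => |boltFun (fun i : Fin n => x (i : ℕ)) F|) :=
  IsBoundedUnder.isCoboundedUnder_le (isBoundedUnder_of ⟨0, fun _ => abs_nonneg _⟩)

theorem limsup_abs_boltFun_nonneg {X : Type*} [TopologicalSpace X] [CompactSpace X]
    (x : ℕ → X) (F : C(X, ℝ)) :
    0 ≤ limsup (fun n : ℕ => |boltFun (fun i : Fin n => x (i : ℕ)) F|) atTop :=
  le_limsup_of_frequently_le (Frequently.of_forall fun _ => abs_nonneg _)
    (isBoundedUnder_abs_boltFun x F)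

theorem abs_alternating_sum_le_of_even_link {a : ℕ → ℝ} {C : ℝ} (ha : ∀ i, |a i| ≤ C)
    (h : ∀ i, Even i → a i = a (i + 1)) (n : ℕ) :
    |∑ i ∈ Finset.range n, (-1 : ℝ) ^ i * a i| ≤ C := by
  have h0 : ∀ k, ∑ i ∈ Finset.range (2 * k), (-1 : ℝ) ^ i * a i = 0 := by
    intro k
    induction k with
    | zero => simp
    | succ k ih =>
      rw [mul_add_one, Finset.sum_range_succ, Finset.sum_range_succ, ih,
        h (2 * k) (even_two_mul k), pow_succ]
      ring
  rcases Nat.even_or_odd' n with ⟨k, rfl | rfl⟩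
  · rw [h0, abs_zero]
    exact (abs_nonneg _).trans (ha 0)
  · rw [Finset.sum_range_succ, h0]
    simpa [abs_mul] using ha (2 * k)

theorem abs_alternating_sum_le_of_odd_link {a : ℕ → ℝ} {C : ℝ} (ha : ∀ i, |a i| ≤ C)
    (h : ∀ i, ¬Even i → a i = a (i + 1)) (n : ℕ) :
    |∑ i ∈ Finset.range n, (-1 : ℝ) ^ i * a i| ≤ 2 * C := by
  have hC : 0 ≤ C := (abs_nonneg _).trans (ha 0)
  cases n with
  | zero => simpa using hC
  | succ n =>
    have hshift := abs_alternating_sum_le_of_even_link (a := fun i => a (i + 1))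
      (fun i => ha (i + 1)) (fun i hi => h (i + 1) (by simpa [Nat.even_add_one] using hi)) n
    have heq : ∑ i ∈ Finset.range (n + 1), (-1 : ℝ) ^ i * a i =
        a 0 - ∑ i ∈ Finset.range n, (-1 : ℝ) ^ i * a (i + 1) := by
      rw [Finset.sum_range_succ']
      simp [pow_succ]
      ring
    rw [heq]
    refine (abs_sub _ _).trans ?_
    linarith [ha 0]

theorem abs_boltFun_le_of_alternating_link {X : Type*} [TopologicalSpace X] [CompactSpace X]
    {x : ℕ → X} {g : C(X, ℝ)}
    (h : (∀ i, Even i → g (x i) = g (x (i + 1))) ∨ (∀ i, ¬Even i → g (x i) = g (x (i + 1))))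
    (n : ℕ) :
    |boltFun (fun i : Fin n => x (i : ℕ)) g| ≤ (n : ℝ)⁻¹ * (2 * ‖g‖) := by
  have hb : ∀ i, |g (x i)| ≤ ‖g‖ := fun i => g.norm_coe_le_norm (x i)
  rw [boltFun_coe, abs_mul, abs_of_nonneg (by positivity : (0 : ℝ) ≤ (n : ℝ)⁻¹)]
  gcongr
  rcases h with h | h
  · exact (abs_alternating_sum_le_of_even_link hb h n).trans (by linarith [norm_nonneg g])
  · exact abs_alternating_sum_le_of_odd_link hb h n

theorem IsInfiniteBolt.limsup_le_norm_sub {X : Type*} [TopologicalSpace X] [CompactSpace X]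
    {A₁ A₂ : Subalgebra ℝ C(X, ℝ)} {x : ℕ → X} (hx : IsInfiniteBolt A₁ A₂ x)
    (f : C(X, ℝ)) {u₁ u₂ : C(X, ℝ)} (h₁ : u₁ ∈ A₁) (h₂ : u₂ ∈ A₂) :
    limsup (fun n : ℕ => |boltFun (fun i : Fin n => x (i : ℕ)) f|) atTop ≤
      ‖f - (u₁ + u₂)‖ := by
  have key₁ : (∀ i, Even i → u₁ (x i) = u₁ (x (i + 1))) ∨
      (∀ i, ¬Even i → u₁ (x i) = u₁ (x (i + 1))) := by
    rcases hx.2 with h | h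
    · refine Or.inl fun i hi => ?_
      have := h i
      rw [if_pos hi] at this
      exact this _ h₁
    · refine Or.inr fun i hi => ?_
      have := h i
      rw [if_neg hi] at this
      exact this _ h₁
  have key₂ : (∀ i, Even i → u₂ (x i) = u₂ (x (i + 1))) ∨
      (∀ i, ¬Even i → u₂ (x i) = u₂ (x (i + 1))) := by
    rcases hx.2 with h | h
    · refine Or.inr fun i hi => ?_
      have := h i
      rw [if_neg hi] at this
      exact this _ h₂
    · refine Or.inl fun i hi => ?_
      have := h i
      rw [if_pos hi] at this
      exact this _ h₂
  have hlim : Tendsto (fun n : ℕ => ‖f - (u₁ + u₂)‖ +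
      (n : ℝ)⁻¹ * (2 * ‖u₁‖ + 2 * ‖u₂‖)) atTop (𝓝 ‖f - (u₁ + u₂)‖) := by
    simpa using tendsto_const_nhds.add
      ((tendsto_inv_atTop_nhds_zero_nat (𝕜 := ℝ)).mul_const (2 * ‖u₁‖ + 2 * ‖u₂‖))
  rw [← hlim.limsup_eq]
  refine limsup_le_limsup (Eventually.of_forall fun n => ?_)
    (isCoboundedUnder_abs_boltFun x f) hlim.isBoundedUnder_le
  have hf : f = (f - (u₁ + u₂)) + (u₁ + u₂) := by abel
  have e : boltFun (fun i : Fin n => x (i : ℕ)) f =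
      boltFun (fun i : Fin n => x (i : ℕ)) (f - (u₁ + u₂)) +
        (boltFun (fun i : Fin n => x (i : ℕ)) u₁ + boltFun (fun i : Fin n => x (i : ℕ)) u₂) := by
    rw [← boltFun_add, ← boltFun_add, ← hf]
  calc |boltFun (fun i : Fin n => x (i : ℕ)) f|
      ≤ |boltFun (fun i : Fin n => x (i : ℕ)) (f - (u₁ + u₂))| +
        (|boltFun (fun i : Fin n => x (i : ℕ)) u₁| +
          |boltFun (fun i : Fin n => x (i : ℕ)) u₂|) := by
        rw [e]
        exact (abs_add_le _ _).trans (by gcongr; exact abs_add_le _ _)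
    _ ≤ ‖f - (u₁ + u₂)‖ + ((n : ℝ)⁻¹ * (2 * ‖u₁‖) + (n : ℝ)⁻¹ * (2 * ‖u₂‖)) :=
        add_le_add (abs_boltFun_le_norm _ _)
          (add_le_add (abs_boltFun_le_of_alternating_link key₁ n)
            (abs_boltFun_le_of_alternating_link key₂ n))
    _ = _ := by ring

/-- The periodic extension of a closed bolt to an infinite sequence. -/
def periodicExt {X : Type*} {m : ℕ} (hm : 0 < m) (x : Fin m → X) (i : ℕ) : X :=
  x ⟨i % m, Nat.mod_lt _ hm⟩

theorem periodicExt_succ {X : Type*} {m : ℕ} (hm : 0 < m) (x : Fin m → X) (i : ℕ) :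
    periodicExt hm x (i + 1) = x (nextIdx ⟨i % m, Nat.mod_lt _ hm⟩) := by
  simp [periodicExt, nextIdx]

theorem IsClosedBolt.isInfiniteBolt_periodicExt {X : Type*} [TopologicalSpace X]
    {A₁ A₂ : Subalgebra ℝ C(X, ℝ)} {m : ℕ} {x : Fin m → X} (hx : IsClosedBolt A₁ A₂ x) :
    IsInfiniteBolt A₁ A₂ (periodicExt hx.1 x) := by
  obtain ⟨hm, hme, hne, hlink⟩ := hx
  have hpar : ∀ i, Even (i % m) ↔ Even i := fun i => by
    rw [Nat.even_iff, Nat.even_iff, Nat.mod_mod_of_dvd i hme.two_dvd]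
  refine ⟨fun i => ?_, ?_⟩
  · rw [periodicExt_succ]
    exact hne _
  · refine hlink.imp (fun h i => ?_) (fun h i => ?_) <;>
    · have := h ⟨i % m, Nat.mod_lt _ hm⟩
      simp only [hpar] at this
      rw [periodicExt_succ]
      exact this

theorem boltFun_periodicExt_mul {X : Type*} [TopologicalSpace X] {m : ℕ} (hm : 0 < m)
    (hme : Even m) (x : Fin m → X) (f : C(X, ℝ)) {k : ℕ} (hk : 0 < k) :
    boltFun (fun i : Fin (m * k) => periodicExt hm x (i : ℕ)) f = boltFun x f := by
  have hbase : ∑ i ∈ Finset.range m, (-1 : ℝ) ^ i * f (periodicExt hm x i) =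
      ∑ i : Fin m, (-1 : ℝ) ^ (i : ℕ) * f (x i) := by
    rw [Finset.sum_range]
    refine Finset.sum_congr rfl fun i _ => ?_
    simp [periodicExt, Nat.mod_eq_of_lt i.isLt]
  have hsum : ∀ k : ℕ, ∑ i ∈ Finset.range (m * k), (-1 : ℝ) ^ i * f (periodicExt hm x i) =
      k * ∑ i : Fin m, (-1 : ℝ) ^ (i : ℕ) * f (x i) := by
    intro k
    induction k with
    | zero => simp
    | succ k ih =>
      rw [mul_add_one, Finset.sum_range_add, ih, ← hbase]
      have : ∀ i, (-1 : ℝ) ^ (m * k + i) * f (periodicExt hm x (m * k + i)) =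
          (-1 : ℝ) ^ i * f (periodicExt hm x i) := fun i => by
        rw [pow_add, (hme.mul_right k).neg_one_pow]
        simp [periodicExt]
      simp only [this]
      push_cast
      ring
  have hk' : (k : ℝ) ≠ 0 := by exact_mod_cast hk.ne'
  have hm' : (m : ℝ) ≠ 0 := by exact_mod_cast hm.ne'
  rw [boltFun_coe, hsum, boltFun]
  push_cast
  field_simp

theorem IsClosedBolt.le_limsup_periodicExt {X : Type*} [TopologicalSpace X] [CompactSpace X]
    {A₁ A₂ : Subalgebra ℝ C(X, ℝ)} {m : ℕ} {x : Fin m → X} (hx : IsClosedBolt A₁ A₂ x)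
    (f : C(X, ℝ)) :
    |boltFun x f| ≤
      limsup (fun n : ℕ => |boltFun (fun i : Fin n => periodicExt hx.1 x (i : ℕ)) f|) atTop := by
  refine le_limsup_of_frequently_le (frequently_atTop.2 fun N => ?_)
    (isBoundedUnder_abs_boltFun _ f)
  refine ⟨m * (N + 1), ?_, ?_⟩
  · exact N.le_succ.trans (Nat.le_mul_of_pos_left _ hx.1)
  · rw [boltFun_periodicExt_mul hx.1 hx.2.1 x f N.succ_pos]

theorem sup_closedBolts_le_sup_infiniteBolts_le_approxError {X : Type*} [MetricSpace X] [CompactSpace X]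
    (A₁ A₂ : Subalgebra ℝ C(X, ℝ))
    (hA₁ : IsClosed (A₁ : Set C(X, ℝ))) (hA₂ : IsClosed (A₂ : Set C(X, ℝ)))
    (f : C(X, ℝ)) :
    sSup {r : ℝ | ∃ (m : ℕ) (x : Fin m → X), IsClosedBolt A₁ A₂ x ∧ r = |boltFun x f|} ≤
      sSup {r : ℝ | ∃ x : ℕ → X, IsInfiniteBolt A₁ A₂ x ∧
        r = Filter.limsup (fun n : ℕ => |boltFun (fun i : Fin n => x (i : ℕ)) f|) atTop} ∧
    sSup {r : ℝ | ∃ x : ℕ → X, IsInfiniteBolt A₁ A₂ x ∧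
        r = Filter.limsup (fun n : ℕ => |boltFun (fun i : Fin n => x (i : ℕ)) f|) atTop}
      ≤ approxError A₁ A₂ f := by
  have hle : ∀ r ∈ {r : ℝ | ∃ x : ℕ → X, IsInfiniteBolt A₁ A₂ x ∧
      r = Filter.limsup (fun n : ℕ => |boltFun (fun i : Fin n => x (i : ℕ)) f|) atTop},
      r ≤ approxError A₁ A₂ f := by
    rintro r ⟨x, hx, rfl⟩
    have : Nonempty (algSum A₁ A₂) := ⟨⟨0 + 0, 0, A₁.zero_mem, 0, A₂.zero_mem, rfl⟩⟩
    refine le_ciInf ?_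
    rintro ⟨_, u₁, h₁, u₂, h₂, rfl⟩
    exact hx.limsup_le_norm_sub f h₁ h₂
  constructor
  · refine Real.sSup_le ?_ (Real.sSup_nonneg ?_)
    · rintro r ⟨m, x, hx, rfl⟩
      exact (hx.le_limsup_periodicExt f).trans
        (le_csSup ⟨_, hle⟩ ⟨_, hx.isInfiniteBolt_periodicExt, rfl⟩)
    · rintro r ⟨x, -, rfl⟩
      exact limsup_abs_boltFun_nonneg x f
  · exact Real.sSup_le hle (Real.iInf_nonneg fun _ => norm_nonneg _)
end
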